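/- arXiv:1308.4879 — 2 statements merged into one kernel-verified Lean document; each statement's English description precedes it below -/
import Mathlib

section
/- Let X, Y be complex-valued random variables on a probability space that are jointly Gaussian and zero-mean. Then the variance of the product satisfies E|X·Y|² − |E(X·Y)|² ≤ 2 · E|X|² · E|Y|². -/
open MeasureTheory ProbabilityTheory

/-- A finite family of complex-valued random variables is jointly Gaussian and
zero-mean if every real linear combination of the real and imaginary parts of
its members has a centered (real) Gaussian distribution. -/
def IsJointGaussianZeroMean {Ω : Type*} [MeasureSpace Ω] {k : ℕ}
    (X : Fin k → Ω → ℂ) : Prop :=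
  ∀ a b : Fin k → ℝ, ∃ v : NNReal,
    Measure.map (fun ω => ∑ i, (a i * (X i ω).re + b i * (X i ω).im)) ℙ
      = gaussianReal 0 v

lemma fourth_moment_gaussian (v : NNReal) :
    (∫ x, x ^ 2 ∂(gaussianReal 0 v)) = v ∧ (∫ x, x ^ 4 ∂(gaussianReal 0 v)) = 3 * (v : ℝ) ^ 2 := by
  have hd : ∀ (n : ℕ) (t : ℝ), HasDerivAt
      (fun t => ∫ x, x ^ n * Real.exp (t * x) ∂(gaussianReal 0 v))
      (∫ x, x ^ (n + 1) * Real.exp (t * x) ∂(gaussianReal 0 v)) t := by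
    intro n t
    exact hasDerivAt_integral_pow_mul_exp_real (X := fun x : ℝ => x) (μ := gaussianReal 0 v)
      (t := t) (by simp) n
  have he : ∀ t : ℝ, HasDerivAt (fun t : ℝ => Real.exp (v * t ^ 2 / 2))
      (v * t * Real.exp (v * t ^ 2 / 2)) t := by
    intro t
    have h1 : HasDerivAt (fun t : ℝ => (v : ℝ) * t ^ 2 / 2) (v * t) t := by
      have := ((hasDerivAt_pow 2 t).const_mul (v : ℝ)).div_const 2
      exact this.congr_deriv (by norm_num; try ring)
    convert h1.exp using 1
    ring
  have step : ∀ (n : ℕ) (p : ℝ → ℝ) (dp : ℝ → ℝ),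
      (∀ t, ∫ x, x ^ n * Real.exp (t * x) ∂(gaussianReal 0 v)
        = p t * Real.exp (v * t ^ 2 / 2)) → (∀ t, HasDerivAt p (dp t) t) →
      ∀ t, ∫ x, x ^ (n + 1) * Real.exp (t * x) ∂(gaussianReal 0 v)
        = (dp t + v * t * p t) * Real.exp (v * t ^ 2 / 2) := by
    intro n p dp hp hdp t
    have h1 := hd n t
    rw [funext hp] at h1
    rw [h1.unique ((hdp t).mul (he t))]
    ring
  have m0 : ∀ t, ∫ x, x ^ 0 * Real.exp (t * x) ∂(gaussianReal 0 v)
        = (1 : ℝ) * Real.exp (v * t ^ 2 / 2) := by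
    intro t
    have := congrFun (mgf_fun_id_gaussianReal (μ := 0) (v := v)) t
    simpa [mgf] using this
  have m1 := step 0 (fun _ => 1) (fun _ => 0) m0 (fun t => hasDerivAt_const _ _)
  have m2 := step 1 (fun t => v * t) (fun _ => v) (by intro t; rw [m1]; ring)
    (fun t => by simpa using (hasDerivAt_id t).const_mul (v : ℝ))
  have m3 := step 2 (fun t => v + v ^ 2 * t ^ 2) (fun t => 2 * v ^ 2 * t)
    (by intro t; rw [m2]; ring)
    (fun t => by
      have := ((hasDerivAt_pow 2 t).const_mul ((v : ℝ) ^ 2)).const_add (v : ℝ)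
      exact this.congr_deriv (by norm_num; try ring))
  have m4 := step 3 (fun t => 3 * v ^ 2 * t + v ^ 3 * t ^ 3)
    (fun t => 3 * v ^ 2 + 3 * v ^ 3 * t ^ 2)
    (by intro t; rw [m3]; ring)
    (fun t => by
      have := ((hasDerivAt_id t).const_mul (3 * (v : ℝ) ^ 2)).add
        ((hasDerivAt_pow 3 t).const_mul ((v : ℝ) ^ 3))
      exact this.congr_deriv (by norm_num; try ring))
  exact ⟨by simpa using m2 0, by simpa using m4 0⟩

/-- Centered real Gaussian random variable. -/
def IsCG {Ω : Type*} [MeasurableSpace Ω] (μ : Measure Ω) (W : Ω → ℝ) : Prop :=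
  ∃ v : NNReal, Measure.map W μ = gaussianReal 0 v

section
variable {Ω : Type*} [MeasurableSpace Ω] {μ : Measure Ω}

lemma IsCG.aem {W : Ω → ℝ} (h : IsCG μ W) : AEMeasurable W μ := by
  obtain ⟨v, hv⟩ := h
  by_contra hn
  rw [Measure.map_of_not_aemeasurable hn] at hv
  exact (IsProbabilityMeasure.ne_zero (gaussianReal 0 v)) hv.symm

lemma IsCG.integrable_pow {W : Ω → ℝ} (h : IsCG μ W) (n : ℕ) :
    Integrable (fun ω => W ω ^ n) μ := by
  have hm := h.aem
  obtain ⟨v, hv⟩ := h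
  have h1 : Integrable (fun x : ℝ => x ^ n) (gaussianReal 0 v) :=
    integrable_pow_of_mem_interior_integrableExpSet (X := fun x : ℝ => x) (by simp) n
  rw [← hv] at h1
  exact h1.comp_aemeasurable hm

lemma IsCG.fourth {W : Ω → ℝ} (h : IsCG μ W) :
    ∫ ω, W ω ^ 4 ∂μ = 3 * (∫ ω, W ω ^ 2 ∂μ) ^ 2 := by
  have hm := h.aem
  obtain ⟨v, hv⟩ := h
  have e : ∀ n : ℕ, ∫ ω, W ω ^ n ∂μ = ∫ x, x ^ n ∂(gaussianReal 0 v) := by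
    intro n
    rw [← hv, integral_map hm (by fun_prop)]
  rw [e, e, (fourth_moment_gaussian v).1, (fourth_moment_gaussian v).2]

lemma pair_int {U V : Ω → ℝ} (hU : IsCG μ U) (hV : IsCG μ V)
    (hp : IsCG μ (fun ω => U ω + V ω)) (hm : IsCG μ (fun ω => U ω - V ω)) :
    Integrable (fun ω => U ω * V ω) μ ∧ Integrable (fun ω => U ω ^ 2 * V ω ^ 2) μ ∧
    ∫ ω, U ω ^ 2 * V ω ^ 2 ∂μ
      = (∫ ω, U ω ^ 2 ∂μ) * (∫ ω, V ω ^ 2 ∂μ) + 2 * (∫ ω, U ω * V ω ∂μ) ^ 2 := by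
  have iUV : Integrable (fun ω => U ω * V ω) μ := by
    refine (((hp.integrable_pow 2).sub (hm.integrable_pow 2)).const_mul (1 / 4)).congr
      (ae_of_all _ fun ω => ?_)
    simp only [Pi.sub_apply]; ring
  have i22 : Integrable (fun ω => U ω ^ 2 * V ω ^ 2) μ := by
    refine ((((hp.integrable_pow 4).add (hm.integrable_pow 4)).sub
      (((hU.integrable_pow 4).add (hV.integrable_pow 4)).const_mul 2)).const_mul (1 / 12)).congr
      (ae_of_all _ fun ω => ?_)
    simp only [Pi.sub_apply, Pi.add_apply]; ring
  refine ⟨iUV, i22, ?_⟩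
  have iU := hU.integrable_pow 2
  have iV := hV.integrable_pow 2
  have e1 : ∫ ω, (U ω + V ω) ^ 2 ∂μ
      = ∫ ω, U ω ^ 2 ∂μ + 2 * ∫ ω, U ω * V ω ∂μ + ∫ ω, V ω ^ 2 ∂μ := by
    rw [← integral_const_mul, ← integral_add iU (iUV.const_mul 2),
      ← integral_add (iU.fun_add (iUV.const_mul 2)) iV]
    congr 1; ext ω; ring
  have e2 : ∫ ω, (U ω - V ω) ^ 2 ∂μ
      = ∫ ω, U ω ^ 2 ∂μ + (-2) * ∫ ω, U ω * V ω ∂μ + ∫ ω, V ω ^ 2 ∂μ := by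
    rw [← integral_const_mul, ← integral_add iU (iUV.const_mul (-2)),
      ← integral_add (iU.fun_add (iUV.const_mul (-2))) iV]
    congr 1; ext ω; ring
  have e3 : ∫ ω, (U ω + V ω) ^ 4 ∂μ + ∫ ω, (U ω - V ω) ^ 4 ∂μ
      = 2 * ∫ ω, U ω ^ 4 ∂μ + 2 * ∫ ω, V ω ^ 4 ∂μ + 12 * ∫ ω, U ω ^ 2 * V ω ^ 2 ∂μ := by
    have jU := (hU.integrable_pow 4).const_mul 2
    have jV := (hV.integrable_pow 4).const_mul 2
    rw [← integral_const_mul, ← integral_const_mul, ← integral_const_mul,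
      ← integral_add (hp.integrable_pow 4) (hm.integrable_pow 4),
      ← integral_add jU jV, ← integral_add (jU.fun_add jV) (i22.const_mul 12)]
    congr 1; ext ω; ring
  rw [hp.fourth, hm.fourth, hU.fourth, hV.fourth, e1, e2] at e3
  linarith

end

theorem variance_of_product_bound {Ω : Type*} [MeasureSpace Ω]
    [IsProbabilityMeasure (ℙ : Measure Ω)] (X Y : Ω → ℂ)
    (h : IsJointGaussianZeroMean ![X, Y]) :
    (∫ ω, ‖X ω * Y ω‖ ^ 2 ∂ℙ) - ‖∫ ω, X ω * Y ω ∂ℙ‖ ^ 2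
      ≤ 2 * (∫ ω, ‖X ω‖ ^ 2 ∂ℙ) * (∫ ω, ‖Y ω‖ ^ 2 ∂ℙ) := by
  have hG : ∀ a b c d : ℝ, IsCG (ℙ : Measure Ω)
      (fun ω => a * (X ω).re + b * (X ω).im + (c * (Y ω).re + d * (Y ω).im)) := by
    intro a b c d
    obtain ⟨v, hv⟩ := h ![a, c] ![b, d]
    exact ⟨v, by simpa [Fin.sum_univ_two] using hv⟩
  have nsq : ∀ z : ℂ, ‖z‖ ^ 2 = z.re ^ 2 + z.im ^ 2 := by
    intro z
    rw [Complex.sq_norm, Complex.normSq_apply]; ring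
  have cg : ∀ (a b c d : ℝ) (W : Ω → ℝ),
      (∀ ω, W ω = a * (X ω).re + b * (X ω).im + (c * (Y ω).re + d * (Y ω).im)) →
      IsCG (ℙ : Measure Ω) W := by
    intro a b c d W hW
    rw [funext hW]; exact hG a b c d
  have gA : IsCG (ℙ : Measure Ω) (fun ω => (X ω).re) := cg 1 0 0 0 _ (fun ω => by ring)
  have gB : IsCG (ℙ : Measure Ω) (fun ω => (X ω).im) := cg 0 1 0 0 _ (fun ω => by ring)
  have gC : IsCG (ℙ : Measure Ω) (fun ω => (Y ω).re) := cg 0 0 1 0 _ (fun ω => by ring)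
  have gD : IsCG (ℙ : Measure Ω) (fun ω => (Y ω).im) := cg 0 0 0 1 _ (fun ω => by ring)
  obtain ⟨iAC, jAC, eAC⟩ := pair_int gA gC (cg 1 0 1 0 _ (fun ω => by ring))
    (cg 1 0 (-1) 0 _ (fun ω => by ring))
  obtain ⟨iAD, jAD, eAD⟩ := pair_int gA gD (cg 1 0 0 1 _ (fun ω => by ring))
    (cg 1 0 0 (-1) _ (fun ω => by ring))
  obtain ⟨iBC, jBC, eBC⟩ := pair_int gB gC (cg 0 1 1 0 _ (fun ω => by ring))
    (cg 0 1 (-1) 0 _ (fun ω => by ring))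
  obtain ⟨iBD, jBD, eBD⟩ := pair_int gB gD (cg 0 1 0 1 _ (fun ω => by ring))
    (cg 0 1 0 (-1) _ (fun ω => by ring))
  have iA := gA.integrable_pow 2
  have iB := gB.integrable_pow 2
  have iC := gC.integrable_pow 2
  have iD := gD.integrable_pow 2
  have hX : ∫ ω, ‖X ω‖ ^ 2 ∂ℙ = ∫ ω, (X ω).re ^ 2 ∂ℙ + ∫ ω, (X ω).im ^ 2 ∂ℙ := by
    rw [← integral_add iA iB]; simp only [nsq]
  have hY : ∫ ω, ‖Y ω‖ ^ 2 ∂ℙ = ∫ ω, (Y ω).re ^ 2 ∂ℙ + ∫ ω, (Y ω).im ^ 2 ∂ℙ := by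
    rw [← integral_add iC iD]; simp only [nsq]
  have hXY : ∫ ω, ‖X ω * Y ω‖ ^ 2 ∂ℙ
      = ∫ ω, (X ω).re ^ 2 * (Y ω).re ^ 2 ∂ℙ + ∫ ω, (X ω).re ^ 2 * (Y ω).im ^ 2 ∂ℙ
        + (∫ ω, (X ω).im ^ 2 * (Y ω).re ^ 2 ∂ℙ + ∫ ω, (X ω).im ^ 2 * (Y ω).im ^ 2 ∂ℙ) := by
    rw [← integral_add jAC jAD, ← integral_add jBC jBD,
      ← integral_add (jAC.fun_add jAD) (jBC.fun_add jBD)]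
    congr 1; ext ω
    simp only [Pi.add_apply, norm_mul, mul_pow, nsq]; ring
  have hE : ∫ ω, X ω * Y ω ∂ℙ
      = ((∫ ω, (X ω).re * (Y ω).re ∂ℙ - ∫ ω, (X ω).im * (Y ω).im ∂ℙ : ℝ) : ℂ)
        + ((∫ ω, (X ω).re * (Y ω).im ∂ℙ + ∫ ω, (X ω).im * (Y ω).re ∂ℙ : ℝ) : ℂ) * Complex.I := by
    rw [← integral_sub iAC iBD, ← integral_add iAD iBC, ← integral_complex_ofReal,
      ← integral_complex_ofReal, ← integral_mul_const,
      ← integral_add (iAC.sub iBD).ofReal ((iAD.add iBC).ofReal.mul_const _)]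
    congr 1; ext ω
    apply Complex.ext <;> simp
  have hN : ‖∫ ω, X ω * Y ω ∂ℙ‖ ^ 2
      = (∫ ω, (X ω).re * (Y ω).re ∂ℙ - ∫ ω, (X ω).im * (Y ω).im ∂ℙ) ^ 2
        + (∫ ω, (X ω).re * (Y ω).im ∂ℙ + ∫ ω, (X ω).im * (Y ω).re ∂ℙ) ^ 2 := by
    rw [hE, nsq]; simp
  rw [hN, hXY, hX, hY, eAC, eAD, eBC, eBD]
  -- Cauchy-Schwarz for `E (X * conj Y)`
  have cs : ∀ p q : ℝ, 0 ≤ (∫ ω, (X ω).re ^ 2 ∂ℙ + ∫ ω, (X ω).im ^ 2 ∂ℙ)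
      + (-2 * p) * (∫ ω, (X ω).re * (Y ω).re ∂ℙ + ∫ ω, (X ω).im * (Y ω).im ∂ℙ)
      + ((-2 * q) * (∫ ω, (X ω).im * (Y ω).re ∂ℙ - ∫ ω, (X ω).re * (Y ω).im ∂ℙ)
      + (p ^ 2 + q ^ 2) * (∫ ω, (Y ω).re ^ 2 ∂ℙ + ∫ ω, (Y ω).im ^ 2 ∂ℙ)) := by
    intro p q
    have k1 := iA.fun_add iB
    have k2 := (iAC.fun_add iBD).const_mul (-2 * p)
    have k0 : Integrable (fun ω => (X ω).im * (Y ω).re - (X ω).re * (Y ω).im) ℙ := iBC.sub iAD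
    have k3 := k0.const_mul (-2 * q)
    have k4 := (iC.fun_add iD).const_mul (p ^ 2 + q ^ 2)
    rw [← integral_add iA iB, ← integral_add iAC iBD, ← integral_sub iBC iAD,
      ← integral_add iC iD, ← integral_const_mul, ← integral_const_mul, ← integral_const_mul,
      ← integral_add k1 k2, ← integral_add k3 k4, ← integral_add (k1.fun_add k2) (k3.fun_add k4)]
    apply integral_nonneg
    intro ω
    have : 0 ≤ ((X ω).re - p * (Y ω).re + q * (Y ω).im) ^ 2
      + ((X ω).im - p * (Y ω).im - q * (Y ω).re) ^ 2 := by positivity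
    simp only [Pi.zero_apply]
    linarith
  have nn : ∀ f : Ω → ℝ, 0 ≤ ∫ ω, f ω ^ 2 ∂ℙ := fun f => integral_nonneg fun ω => sq_nonneg _
  have hab := add_nonneg (nn fun ω => (X ω).re) (nn fun ω => (X ω).im)
  have hcd := add_nonneg (nn fun ω => (Y ω).re) (nn fun ω => (Y ω).im)
  clear hN hXY hX hY eAC eAD eBC eBD hE nn
  generalize (∫ ω, (X ω).re ^ 2 ∂ℙ) = a at *
  generalize (∫ ω, (X ω).im ^ 2 ∂ℙ) = b at *
  generalize (∫ ω, (Y ω).re ^ 2 ∂ℙ) = c at *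
  generalize (∫ ω, (Y ω).im ^ 2 ∂ℙ) = d at *
  generalize (∫ ω, (X ω).re * (Y ω).re ∂ℙ) = r at *
  generalize (∫ ω, (X ω).im * (Y ω).im ∂ℙ) = s at *
  generalize (∫ ω, (X ω).re * (Y ω).im ∂ℙ) = t at *
  generalize (∫ ω, (X ω).im * (Y ω).re ∂ℙ) = u at *
  have key : (r + s) ^ 2 + (u - t) ^ 2 ≤ (a + b) * (c + d) := by
    have hN0 : 0 ≤ (r + s) ^ 2 + (u - t) ^ 2 := by positivity
    have hdisc := discrim_le_zero (a := ((r + s) ^ 2 + (u - t) ^ 2) * (c + d))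
      (b := -2 * ((r + s) ^ 2 + (u - t) ^ 2)) (c := a + b) (fun x => by
        have := cs (x * (r + s)) (x * (u - t))
        linarith)
    unfold discrim at hdisc
    rcases hN0.eq_or_lt with h0 | h0
    · rw [← h0]
      exact mul_nonneg hab hcd
    · by_contra hneg
      push Not at hneg
      have := mul_pos h0 (sub_pos.2 hneg)
      linarith
  linarith
end

section
/- Let X, Y_L, Y_S, X', Y' be complex-valued random variables on a probability space that are jointly Gaussian and zero-mean, and suppose that the pair (X, Y_L) is independent of the pair (X', Y'). Put Y = Y_L + Y_S. Then |E(X·Y·conj(X'·Y')) − E(X·Y)·conj(E(X'·Y'))| ≤ 4·√(E|X|² · E|Y_S|² · E|X'|² · E|Y'|²). -/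
open MeasureTheory ProbabilityTheory

lemma gauss_deriv (v : ℝ) : iteratedDeriv 4 (fun t : ℝ => Real.exp (v * t ^ 2 / 2)) 0 = 3 * v ^ 2 := by
  have key : ∀ (p p' : ℝ → ℝ), (∀ t, HasDerivAt p (p' t) t) →
      deriv (fun t : ℝ => p t * Real.exp (v * t ^ 2 / 2)) =
        fun t => (p' t + p t * (v * t)) * Real.exp (v * t ^ 2 / 2) := by
    intro p p' hp
    funext t
    have h1 : HasDerivAt (fun t : ℝ => v * t ^ 2 / 2) (v * t) t := by
      have := ((hasDerivAt_pow 2 t).const_mul v).div_const 2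
      convert! this using 1
      push_cast; ring
    have := (hp t).mul h1.exp
    rw [show (fun t : ℝ => p t * Real.exp (v * t ^ 2 / 2)) = p * (fun t : ℝ => Real.exp (v * t ^ 2 / 2)) from rfl, this.deriv]
    ring
  have e0 : (fun t : ℝ => Real.exp (v * t ^ 2 / 2)) = fun t => (fun _ => (1:ℝ)) t * Real.exp (v * t ^ 2 / 2) := by
    funext t; simp
  have c : ∀ (n : ℕ) (a t : ℝ), HasDerivAt (fun t : ℝ => a * t ^ n) (a * (n * t ^ (n-1))) t :=
    fun n a t => (hasDerivAt_pow n t).const_mul a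
  rw [iteratedDeriv_eq_iterate]
  simp only [Function.iterate_succ, Function.iterate_zero, Function.comp, id]
  rw [e0, key (fun _ => 1) (fun _ => 0) (fun t => hasDerivAt_const t 1)]
  rw [key (fun t => 0 + 1 * (v * t)) (fun _ => v) (fun t => by
    have := c 1 v t
    simpa using this)]
  rw [key (fun t => v + (0 + 1 * (v * t)) * (v * t)) (fun t => v ^ 2 * (2 * t)) (fun t => by
    have := (c 2 (v ^ 2) t).const_add v
    convert! this using 1
    · funext s; ring
    · push_cast; ring)]
  rw [key (fun t => v ^ 2 * (2 * t) + (v + (0 + 1 * (v * t)) * (v * t)) * (v * t))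
      (fun t => 3 * v ^ 2 + v ^ 3 * (3 * t ^ 2)) (fun t => by
    have := (c 1 (3 * v ^ 2) t).add (c 3 (v ^ 3) t)
    convert! this using 1
    · funext s; simp; ring
    · push_cast; ring)]
  simp

lemma gauss_mom4 (v : NNReal) : ∫ x, x ^ 4 ∂(gaussianReal 0 v) = 3 * (v:ℝ) ^ 2 := by
  have h := iteratedDeriv_mgf_zero (X := id) (μ := gaussianReal 0 v) (by simp) 4
  rw [mgf_id_gaussianReal] at h
  simp only [zero_mul, zero_add] at h
  rw [gauss_deriv] at h
  simpa using h.symm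

lemma gauss_mom2 (v : NNReal) : ∫ x, x ^ 2 ∂(gaussianReal 0 v) = (v:ℝ) := by
  have h := variance_fun_id_gaussianReal (μ := 0) (v := v)
  rw [variance_eq_integral measurable_id'.aemeasurable] at h
  simpa using h

section
variable {Ω : Type*} [MeasurableSpace Ω] {P : Measure Ω}

lemma map_facts {f : Ω → ℝ} {v : NNReal} (h : P.map f = gaussianReal 0 v) :
    AEMeasurable f P ∧ MemLp f 4 P ∧ ∫ ω, f ω ∂P = 0 ∧
      ∫ ω, f ω ^ 4 ∂P = 3 * (∫ ω, f ω ^ 2 ∂P) ^ 2 := by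
  have hf : AEMeasurable f P := by
    by_contra hn
    rw [Measure.map_of_not_aemeasurable hn] at h
    exact IsProbabilityMeasure.ne_zero (gaussianReal 0 v) h.symm
  refine ⟨hf, ?_, ?_, ?_⟩
  · have := memLp_id_gaussianReal' (μ := 0) (v := v) 4 (by simp)
    rw [← h] at this
    exact (memLp_map_measure_iff aestronglyMeasurable_id hf).1 this
  · have := integral_map (μ := P) hf (f := fun x : ℝ => x) (by fun_prop)
    rw [← this, h, integral_id_gaussianReal]
  · have h4 := integral_map (μ := P) hf (f := fun x : ℝ => x ^ 4) (by fun_prop)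
    have h2 := integral_map (μ := P) hf (f := fun x : ℝ => x ^ 2) (by fun_prop)
    rw [← h4, ← h2, h, gauss_mom4, gauss_mom2]

lemma int2 [IsProbabilityMeasure P] {a b : Ω → ℝ} (ha : MemLp a 4 P) (hb : MemLp b 4 P) :
    Integrable (fun ω => a ω * b ω) P := by
  have h : (2 : ENNReal) ≤ 4 := by norm_num
  exact (ha.mono_exponent h).integrable_mul (hb.mono_exponent h)

lemma int4 {a b c d : Ω → ℝ} (ha : MemLp a 4 P) (hb : MemLp b 4 P)
    (hc : MemLp c 4 P) (hd : MemLp d 4 P) :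
    Integrable (fun ω => a ω * b ω * (c ω * d ω)) P := by
  have : ENNReal.HolderTriple 4 4 2 := ⟨by
    rw [← two_mul, show (4 : ENNReal) = 2 * 2 by norm_num,
      ENNReal.mul_inv (by simp) (by simp), ← mul_assoc, ENNReal.mul_inv_cancel (by simp) (by simp),
      one_mul]⟩
  have h1 : MemLp (fun ω => a ω * b ω) 2 P := hb.mul ha
  have h2 : MemLp (fun ω => c ω * d ω) 2 P := hd.mul hc
  exact h1.integrable_mul h2

lemma wick [IsProbabilityMeasure P] {a b c d : Ω → ℝ}
    (H : ∀ s t u w : ℝ, ∃ v : NNReal,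
      P.map (fun ω => s * a ω + t * b ω + u * c ω + w * d ω) = gaussianReal 0 v)
    (ha : MemLp a 4 P) (hb : MemLp b 4 P) (hc : MemLp c 4 P) (hd : MemLp d 4 P) :
    ∫ ω, a ω * b ω * (c ω * d ω) ∂P =
      (∫ ω, a ω * b ω ∂P) * (∫ ω, c ω * d ω ∂P) + (∫ ω, a ω * c ω ∂P) * (∫ ω, b ω * d ω ∂P)
      + (∫ ω, a ω * d ω ∂P) * (∫ ω, b ω * c ω ∂P) := by
  have lin2 : ∀ s t u w : ℝ, ∫ ω, (s * a ω + t * b ω + u * c ω + w * d ω) ^ 2 ∂P =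
      s^2 * (∫ ω, a ω * a ω ∂P) + t^2 * (∫ ω, b ω * b ω ∂P) + u^2 * (∫ ω, c ω * c ω ∂P)
      + w^2 * (∫ ω, d ω * d ω ∂P) + 2*s*t * (∫ ω, a ω * b ω ∂P) + 2*s*u * (∫ ω, a ω * c ω ∂P)
      + 2*s*w * (∫ ω, a ω * d ω ∂P) + 2*t*u * (∫ ω, b ω * c ω ∂P)
      + 2*t*w * (∫ ω, b ω * d ω ∂P) + 2*u*w * (∫ ω, c ω * d ω ∂P) := by
    intro s t u w
    have i1 := (int2 ha ha).const_mul (s^2)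
    have i2 := (int2 hb hb).const_mul (t^2)
    have i3 := (int2 hc hc).const_mul (u^2)
    have i4 := (int2 hd hd).const_mul (w^2)
    have i5 := (int2 ha hb).const_mul (2*s*t)
    have i6 := (int2 ha hc).const_mul (2*s*u)
    have i7 := (int2 ha hd).const_mul (2*s*w)
    have i8 := (int2 hb hc).const_mul (2*t*u)
    have i9 := (int2 hb hd).const_mul (2*t*w)
    have i10 := (int2 hc hd).const_mul (2*u*w)
    simp only [← integral_const_mul]
    rw [← integral_add (by fun_prop) (by fun_prop), ← integral_add (by fun_prop) (by fun_prop),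
      ← integral_add (by fun_prop) (by fun_prop), ← integral_add (by fun_prop) (by fun_prop),
      ← integral_add (by fun_prop) (by fun_prop), ← integral_add (by fun_prop) (by fun_prop),
      ← integral_add (by fun_prop) (by fun_prop), ← integral_add (by fun_prop) (by fun_prop),
      ← integral_add (by fun_prop) (by fun_prop)]
    congr 1
    funext ω
    ring
  have lin4 : ∀ s t u w : ℝ, ∫ ω, (s * a ω + t * b ω + u * c ω + w * d ω) ^ 4 ∂P =
      3 * (∫ ω, (s * a ω + t * b ω + u * c ω + w * d ω) ^ 2 ∂P) ^ 2 := by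
    intro s t u w
    obtain ⟨v, hv⟩ := H s t u w
    exact (map_facts hv).2.2.2
  have I4 : ∀ s t u w : ℝ, Integrable (fun ω => (s * a ω + t * b ω + u * c ω + w * d ω) ^ 4) P := by
    intro s t u w
    obtain ⟨v, hv⟩ := H s t u w
    have m := (map_facts hv).2.1
    refine (int4 m m m m).congr (Filter.Eventually.of_forall fun ω => ?_)
    simp only
    ring
  have pol : ∫ ω, a ω * b ω * (c ω * d ω) ∂P = 1/192 * (
      ((∫ ω, (1 * a ω + 1 * b ω + 1 * c ω + 1 * d ω) ^ 4 ∂P)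
      + (∫ ω, (1 * a ω + 1 * b ω + (-1) * c ω + (-1) * d ω) ^ 4 ∂P)
      + (∫ ω, (1 * a ω + (-1) * b ω + 1 * c ω + (-1) * d ω) ^ 4 ∂P)
      + (∫ ω, (1 * a ω + (-1) * b ω + (-1) * c ω + 1 * d ω) ^ 4 ∂P))
      - ((∫ ω, (1 * a ω + 1 * b ω + 1 * c ω + (-1) * d ω) ^ 4 ∂P)
      + (∫ ω, (1 * a ω + 1 * b ω + (-1) * c ω + 1 * d ω) ^ 4 ∂P)
      + (∫ ω, (1 * a ω + (-1) * b ω + 1 * c ω + 1 * d ω) ^ 4 ∂P)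
      + (∫ ω, ((-1) * a ω + 1 * b ω + 1 * c ω + 1 * d ω) ^ 4 ∂P))) := by
    have j1 := I4 1 1 1 1
    have j2 := I4 1 1 (-1) (-1)
    have j3 := I4 1 (-1) 1 (-1)
    have j4 := I4 1 (-1) (-1) 1
    have j5 := I4 1 1 1 (-1)
    have j6 := I4 1 1 (-1) 1
    have j7 := I4 1 (-1) 1 1
    have j8 := I4 (-1) 1 1 1
    rw [← integral_add j1 j2, ← integral_add (j1.fun_add j2) j3,
      ← integral_add ((j1.fun_add j2).fun_add j3) j4,
      ← integral_add j5 j6, ← integral_add (j5.fun_add j6) j7,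
      ← integral_add ((j5.fun_add j6).fun_add j7) j8,
      ← integral_sub (((j1.fun_add j2).fun_add j3).fun_add j4) (((j5.fun_add j6).fun_add j7).fun_add j8),
      ← integral_const_mul]
    congr 1
    funext ω
    ring
  rw [pol]
  simp only [lin4, lin2]
  ring

lemma indep_wick [IsProbabilityMeasure P] {a b c d : Ω → ℝ}
    (H : ∀ s t u w : ℝ, ∃ v : NNReal,
      P.map (fun ω => s * a ω + t * b ω + u * c ω + w * d ω) = gaussianReal 0 v)
    (hac : IndepFun a c P) (had : IndepFun a d P) :
    MemLp a 4 P ∧ MemLp b 4 P ∧ MemLp c 4 P ∧ MemLp d 4 P ∧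
    ∫ ω, a ω * b ω * (c ω * d ω) ∂P =
      (∫ ω, a ω * b ω ∂P) * (∫ ω, c ω * d ω ∂P) := by
  obtain ⟨va, h1⟩ := H 1 0 0 0
  obtain ⟨vb, h2⟩ := H 0 1 0 0
  obtain ⟨vc, h3⟩ := H 0 0 1 0
  obtain ⟨vd, h4⟩ := H 0 0 0 1
  simp only [one_mul, zero_mul, add_zero, zero_add] at h1 h2 h3 h4
  have m1 := map_facts h1
  have m2 := map_facts h2
  have m3 := map_facts h3
  have m4 := map_facts h4
  refine ⟨m1.2.1, m2.2.1, m3.2.1, m4.2.1, ?_⟩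
  rw [wick H m1.2.1 m2.2.1 m3.2.1 m4.2.1,
    hac.integral_fun_mul_eq_mul_integral m1.1.aestronglyMeasurable m3.1.aestronglyMeasurable,
    had.integral_fun_mul_eq_mul_integral m1.1.aestronglyMeasurable m4.1.aestronglyMeasurable,
    m1.2.2.1]
  ring

end

/-- real and imaginary parts -/
def part (r : Fin 2) (z : ℂ) : ℝ := if r = 0 then z.re else z.im

lemma part_meas (r : Fin 2) : Measurable (part r) := by
  unfold part; split_ifs <;> fun_prop

def wt (r : Fin 2) : ℂ := if r = 0 then 1 else Complex.I

lemma sum_part (z : ℂ) : z = ∑ r, wt r * (part r z : ℂ) := by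
  simp [part, wt, Fin.sum_univ_two, mul_comm Complex.I]

lemma sum_part_star (z : ℂ) : star z = ∑ r, star (wt r) * (part r z : ℂ) := by
  conv_lhs => rw [sum_part z]
  simp

lemma comb_of_joint {Ω : Type*} [MeasureSpace Ω] (X YL YS X' Y' : Ω → ℂ)
    (h : IsJointGaussianZeroMean ![X, YL, YS, X', Y']) (i j k l : Fin 2) (s t u w : ℝ) :
    ∃ v : NNReal, Measure.map (fun ω => s * part i (X ω) + t * part j (YL ω + YS ω)
      + u * part k (X' ω) + w * part l (Y' ω)) ℙ = gaussianReal 0 v := by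
  let e : Fin 2 → ℝ := fun r => if r = 0 then 1 else 0
  let f : Fin 2 → ℝ := fun r => if r = 0 then 0 else 1
  obtain ⟨v, hv⟩ := h ![s * e i, t * e j, t * e j, u * e k, w * e l]
    ![s * f i, t * f j, t * f j, u * f k, w * f l]
  refine ⟨v, hv ▸ ?_⟩
  congr 1
  funext ω
  have hp : ∀ r z, part r z = e r * z.re + f r * z.im := by
    intro r z; simp only [part, e, f]; split_ifs <;> simp
  simp only [hp, Fin.sum_univ_five]
  simp
  ring

theorem crosscorrelation_decay {Ω : Type*} [MeasureSpace Ω]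
    [IsProbabilityMeasure (ℙ : Measure Ω)] (X YL YS X' Y' : Ω → ℂ)
    (h : IsJointGaussianZeroMean ![X, YL, YS, X', Y'])
    (hindep : IndepFun (fun ω => (X ω, YL ω)) (fun ω => (X' ω, Y' ω)) ℙ) :
    ‖(∫ ω, X ω * (YL ω + YS ω) * star (X' ω * Y' ω) ∂ℙ)
        - (∫ ω, X ω * (YL ω + YS ω) ∂ℙ) * star (∫ ω, X' ω * Y' ω ∂ℙ)‖
      ≤ 4 * Real.sqrt ((∫ ω, ‖X ω‖ ^ 2 ∂ℙ) * (∫ ω, ‖YS ω‖ ^ 2 ∂ℙ)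
          * (∫ ω, ‖X' ω‖ ^ 2 ∂ℙ) * (∫ ω, ‖Y' ω‖ ^ 2 ∂ℙ)) := by
  -- by the Wick formula the left-hand side vanishes
  have key : ∀ i j k l : Fin 2, _ := fun i j k l =>
    indep_wick (P := (ℙ : Measure Ω)) (a := fun ω => part i (X ω))
      (b := fun ω => part j (YL ω + YS ω))
      (c := fun ω => part k (X' ω)) (d := fun ω => part l (Y' ω))
      (comb_of_joint X YL YS X' Y' h i j k l)
      (hindep.comp (φ := fun p : ℂ × ℂ => part i p.1) (ψ := fun p : ℂ × ℂ => part k p.1)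
        ((part_meas i).comp measurable_fst) ((part_meas k).comp measurable_fst))
      (hindep.comp (φ := fun p : ℂ × ℂ => part i p.1) (ψ := fun p : ℂ × ℂ => part l p.2)
        ((part_meas i).comp measurable_fst) ((part_meas l).comp measurable_snd))
  have mX : ∀ i, MemLp (fun ω => part i (X ω)) 4 ℙ := fun i => (key i 0 0 0).1
  have mY : ∀ i, MemLp (fun ω => part i (YL ω + YS ω)) 4 ℙ := fun i => (key 0 i 0 0).2.1
  have mX' : ∀ i, MemLp (fun ω => part i (X' ω)) 4 ℙ := fun i => (key 0 0 i 0).2.2.1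
  have mY' : ∀ i, MemLp (fun ω => part i (Y' ω)) 4 ℙ := fun i => (key 0 0 0 i).2.2.2.1
  have E4 : ∫ ω, X ω * (YL ω + YS ω) * star (X' ω * Y' ω) ∂ℙ =
      ∑ i, ∑ j, ∑ k, ∑ l, wt i * wt j * (star (wt k) * star (wt l)) *
        ((∫ ω, part i (X ω) * part j (YL ω + YS ω) *
          (part k (X' ω) * part l (Y' ω)) ∂ℙ : ℝ) : ℂ) := by
    have I : ∀ i j k l, Integrable (fun ω => wt i * wt j * (star (wt k) * star (wt l)) *
        ((part i (X ω) * part j (YL ω + YS ω) *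
          (part k (X' ω) * part l (Y' ω)) : ℝ) : ℂ)) ℙ := fun i j k l =>
      ((int4 (mX i) (mY j) (mX' k) (mY' l)).ofReal (𝕜 := ℂ)).const_mul _
    simp only [← integral_complex_ofReal, ← integral_const_mul]
    simp_rw [← integral_finsetSum Finset.univ (fun l _ => I _ _ _ l)]
    simp_rw [← integral_finsetSum Finset.univ (fun k _ => integrable_finsetSum Finset.univ (fun l _ => I _ _ k l))]
    simp_rw [← integral_finsetSum Finset.univ (fun j _ => integrable_finsetSum Finset.univ (fun k _ => integrable_finsetSum Finset.univ (fun l _ => I _ j k l)))]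
    rw [← integral_finsetSum Finset.univ (fun i _ => integrable_finsetSum Finset.univ (fun j _ => integrable_finsetSum Finset.univ (fun k _ => integrable_finsetSum Finset.univ (fun l _ => I i j k l))))]
    congr 1
    funext ω
    rw [star_mul', sum_part_star (X' ω), sum_part_star (Y' ω)]
    conv_lhs => rw [sum_part (X ω), sum_part (YL ω + YS ω)]
    simp only [Fin.sum_univ_two]
    push_cast
    ring
  have E2 : ∀ A B : Ω → ℂ, (∀ i, MemLp (fun ω => part i (A ω)) 4 ℙ) →
      (∀ i, MemLp (fun ω => part i (B ω)) 4 ℙ) →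
      ∫ ω, A ω * B ω ∂ℙ = ∑ i, ∑ j, wt i * wt j *
        ((∫ ω, part i (A ω) * part j (B ω) ∂ℙ : ℝ) : ℂ) := by
    intro A B hA hB
    have I : ∀ i j, Integrable (fun ω => wt i * wt j *
        ((part i (A ω) * part j (B ω) : ℝ) : ℂ)) ℙ := fun i j =>
      ((int2 (hA i) (hB j)).ofReal (𝕜 := ℂ)).const_mul _
    simp only [← integral_complex_ofReal, ← integral_const_mul]
    simp_rw [← integral_finsetSum Finset.univ (fun j _ => I _ j)]
    rw [← integral_finsetSum Finset.univ (fun i _ => integrable_finsetSum Finset.univ (fun j _ => I i j))]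
    congr 1
    funext ω
    conv_lhs => rw [sum_part (A ω), sum_part (B ω)]
    simp only [Fin.sum_univ_two]
    push_cast
    ring
  have zero : (∫ ω, X ω * (YL ω + YS ω) * star (X' ω * Y' ω) ∂ℙ)
        - (∫ ω, X ω * (YL ω + YS ω) ∂ℙ) * star (∫ ω, X' ω * Y' ω ∂ℙ) = 0 := by
    rw [E4, E2 X (fun ω => YL ω + YS ω) mX mY, E2 X' Y' mX' mY']
    simp only [(key _ _ _ _).2.2.2.2]
    simp only [Fin.sum_univ_two, star_add, star_mul', Complex.star_def, Complex.conj_ofReal]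
    push_cast
    ring
  rw [zero, norm_zero]
  positivity
end
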